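/- Correctness of Marsaglia's method for n = 4: if (X₁, X₂) and (a, b) are independent, each uniformly distributed on the unit disk {(u,v) : u² + v² ≤ 1}, and S₁ = X₁² + X₂², S₂ = a² + b², then the random vector (X₁, X₂, a·√((1−S₁)/S₂), b·√((1−S₁)/S₂)) is uniformly distributed on the unit sphere S³ ⊂ ℝ⁴. -/

import Mathlib

open MeasureTheory ProbabilityTheory Metric

/-- A measure is the uniform distribution on the unit sphere of a real inner product
space iff it is a (rotation-invariant) Borel probability measure concentrated on the
unit sphere that is invariant under every linear isometry. -/
def IsUniformSphere {E : Type*} [NormedAddCommGroup E] [InnerProductSpace ℝ E]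
    [MeasurableSpace E] [BorelSpace E] (μ : Measure E) : Prop :=
  IsProbabilityMeasure μ ∧ μ (Metric.sphere (0 : E) 1)ᶜ = 0 ∧
    ∀ e : E ≃ₗᵢ[ℝ] E, μ.map e = μ

/-- The uniform distribution on the closed unit ball of `ℝⁿ`:
normalized Lebesgue measure restricted to the ball. -/
noncomputable def uniformBall (n : ℕ) : Measure (EuclideanSpace ℝ (Fin n)) :=
  (volume (Metric.closedBall (0 : EuclideanSpace ℝ (Fin n)) 1))⁻¹ •
    volume.restrict (Metric.closedBall (0 : EuclideanSpace ℝ (Fin n)) 1)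

theorem one_sub_norm_sq_pos_of_mem_ball {E : Type*} [NormedAddCommGroup E] {x : E}
    (hx : x ∈ ball (0 : E) 1) : 0 < 1 - ‖x‖ ^ 2 := by
  have := mem_ball_zero_iff.1 hx
  nlinarith [norm_nonneg x]

section
variable {E F : Type*} [NormedAddCommGroup E] [NormedAddCommGroup F] [InnerProductSpace ℝ F]

/-- The point of the unit sphere obtained from `p` in the unit ball of `E` by choosing its
`F`-component in the direction of `q`. -/
noncomputable def sphereLift (z : E × F) : WithLp 2 (E × F) :=
  WithLp.toLp 2 (z.1, (√(1 - ‖z.1‖ ^ 2) / ‖z.2‖) • z.2)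

theorem norm_sphereLift {z : E × F} (hp : ‖z.1‖ ≤ 1) (hq : z.2 ≠ 0) : ‖sphereLift z‖ = 1 := by
  have hpos : 0 ≤ 1 - ‖z.1‖ ^ 2 := by nlinarith [norm_nonneg z.1]
  have hq' : ‖z.2‖ ≠ 0 := norm_ne_zero_iff.2 hq
  rw [← sq_eq_sq₀ (norm_nonneg _) zero_le_one, WithLp.prod_norm_sq_eq_of_L2]
  simp only [sphereLift, WithLp.toLp_fst, WithLp.toLp_snd, norm_smul, norm_div, norm_norm,
    Real.norm_of_nonneg (Real.sqrt_nonneg _)]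
  rw [div_mul_cancel₀ _ hq', Real.sq_sqrt hpos]
  ring

theorem norm_smul_sphereLift [InnerProductSpace ℝ E] {z : E × F} (hq : z.2 ≠ 0) :
    ‖z.2‖ • sphereLift z = WithLp.toLp 2 (‖z.2‖ • z.1, √(1 - ‖z.1‖ ^ 2) • z.2) := by
  have hq' : ‖z.2‖ ≠ 0 := norm_ne_zero_iff.2 hq
  rw [sphereLift, ← WithLp.toLp_smul, Prod.smul_mk, smul_smul, mul_div_cancel₀ _ hq']

theorem measurable_sphereLift [MeasurableSpace E] [BorelSpace E] [FiniteDimensional ℝ F]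
    [MeasurableSpace F] [BorelSpace F] : Measurable (sphereLift : E × F → WithLp 2 (E × F)) := by
  refine (WithLp.measurable_toLp 2 (E × F)).comp ?_
  fun_prop

end

section
variable {E : Type*} [NormedAddCommGroup E] [InnerProductSpace ℝ E] [FiniteDimensional ℝ E]
open Module

theorem exists_hasFDerivAt_univUnitBall_symm {x : E} (hx : x ∈ ball (0 : E) 1) :
    ∃ D : E →L[ℝ] E, HasFDerivAt (OpenPartialHomeomorph.univUnitBall (E := E)).symm D x ∧
      D.det = (√(1 - ‖x‖ ^ 2))⁻¹ ^ (finrank ℝ E + 2) := by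
  have hpos := one_sub_norm_sq_pos_of_mem_ball hx
  set r := √(1 - ‖x‖ ^ 2) with hr
  have hr0 : 0 < r := Real.sqrt_pos.2 hpos
  have hr2 : r ^ 2 = 1 - ‖x‖ ^ 2 := Real.sq_sqrt hpos.le
  let T : E →ₗ[ℝ] E := LinearMap.transvection ((r⁻¹ ^ 2) • (innerSL ℝ x : E →L[ℝ] ℝ).toLinearMap) x
  refine ⟨LinearMap.toContinuousLinearMap (r⁻¹ • T), ?_, ?_⟩
  · have h1 : HasFDerivAt (fun y : E => 1 - ‖y‖ ^ 2) (-(2 • innerSL ℝ x)) x :=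
      (hasStrictFDerivAt_norm_sq x).hasFDerivAt.const_sub 1
    have h2 := ((hasDerivAt_inv hr0.ne').comp_hasFDerivAt x (h1.sqrt hpos.ne')).smul
      (hasFDerivAt_id x)
    refine h2.congr_fderiv ?_
    ext y
    simp [T, LinearMap.transvection.apply, ← hr, smul_smul]
    congr 1
    field_simp
  · rw [LinearMap.det_toContinuousLinearMap, LinearMap.det_smul, LinearMap.transvection.det]
    have : 1 + (r⁻¹ ^ 2 • (innerSL ℝ x : E →L[ℝ] ℝ).toLinearMap) x = r⁻¹ ^ 2 := by
      simp
      field_simp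
      linarith
    rw [this, pow_add]

variable [MeasurableSpace E] [BorelSpace E]

theorem lintegral_eq_lintegral_univUnitBall_symm (g : E → ENNReal) :
    ∫⁻ x, g x = ∫⁻ p in ball (0 : E) 1, ENNReal.ofReal ((√(1 - ‖p‖ ^ 2))⁻¹ ^ (finrank ℝ E + 2)) *
      g ((√(1 - ‖p‖ ^ 2))⁻¹ • p) := by
  choose! D hD hdet using fun x : E => exists_hasFDerivAt_univUnitBall_symm (x := x)
  have key := lintegral_image_eq_lintegral_abs_det_fderiv_mul volume
    (measurableSet_ball (x := (0 : E)) (ε := 1))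
    (fun x hx => (hD x hx).hasFDerivWithinAt)
    (OpenPartialHomeomorph.univUnitBall (E := E)).symm.injOn g
  have himage : (OpenPartialHomeomorph.univUnitBall (E := E)).symm '' ball (0 : E) 1 = Set.univ :=
    (OpenPartialHomeomorph.univUnitBall (E := E)).symm_image_target_eq_source
  rw [himage, setLIntegral_univ] at key
  rw [key]
  refine setLIntegral_congr_fun measurableSet_ball fun x hx => ?_
  simp only [hdet x hx, OpenPartialHomeomorph.univUnitBall_symm_apply]
  rw [abs_of_nonneg (by positivity)]

theorem lintegral_eq_mul_lintegral_comp_smul (g : E → ENNReal) {r : ℝ} (hr : 0 < r) :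
    ∫⁻ x, g x = ENNReal.ofReal (r ^ finrank ℝ E) * ∫⁻ x : E, g (r • x) := by
  have h := lintegral_map_equiv (μ := (volume : Measure E)) g
    (Homeomorph.smulOfNeZero r hr.ne').toMeasurableEquiv
  have h2 := Measure.map_addHaar_smul (volume : Measure E) hr.ne'
  have h3 : ∫⁻ x : E, g (r • x) = ∫⁻ x, g x ∂(volume : Measure E).map (r • ·) := h.symm
  rw [h3, h2, lintegral_smul_measure, smul_eq_mul, ← mul_assoc, ← ENNReal.ofReal_mul (by positivity),
    abs_of_pos (by positivity), mul_inv_cancel₀ (by positivity)]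
  simp

variable {F : Type*} [NormedAddCommGroup F] [InnerProductSpace ℝ F] [FiniteDimensional ℝ F]
  [MeasurableSpace F] [BorelSpace F]

theorem lintegral_prod_eq_lintegral_ball_prod (hE : finrank ℝ E = 2) (hF : finrank ℝ F = 2)
    {g : E × F → ENNReal} (hg : Measurable g) :
    ∫⁻ z, g z = ∫⁻ p in ball (0 : E) 1, ∫⁻ q : F,
      ENNReal.ofReal (‖q‖ ^ 2) * g (‖q‖ • p, √(1 - ‖p‖ ^ 2) • q) := by
  have : Nontrivial F := nontrivial_of_finrank_pos (R := ℝ) (by omega)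
  have inner_eq (y : F) (hy : y ≠ 0) : ∫⁻ x : E, g (x, y) = ∫⁻ p in ball (0 : E) 1,
      ENNReal.ofReal (‖y‖ ^ 2 * (√(1 - ‖p‖ ^ 2))⁻¹ ^ 4) *
        g ((‖y‖ * (√(1 - ‖p‖ ^ 2))⁻¹) • p, y) := by
    rw [lintegral_eq_mul_lintegral_comp_smul _ (norm_pos_iff.2 hy),
      lintegral_eq_lintegral_univUnitBall_symm, hE,
      ← lintegral_const_mul' _ _ ENNReal.ofReal_ne_top]
    simp_rw [← mul_assoc, ← ENNReal.ofReal_mul (sq_nonneg ‖y‖), smul_smul]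
  rw [Measure.volume_eq_prod, lintegral_prod_symm _ hg.aemeasurable,
    lintegral_congr_ae ((Measure.ae_ne volume (0 : F)).mono inner_eq),
    lintegral_lintegral_swap (by fun_prop)]
  refine setLIntegral_congr_fun measurableSet_ball fun p hp => ?_
  have hpos := one_sub_norm_sq_pos_of_mem_ball hp
  have hr0 : 0 < √(1 - ‖p‖ ^ 2) := Real.sqrt_pos.2 hpos
  generalize √(1 - ‖p‖ ^ 2) = r at hr0
  rw [lintegral_eq_mul_lintegral_comp_smul _ hr0, hF,
    ← lintegral_const_mul' _ _ ENNReal.ofReal_ne_top]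
  refine lintegral_congr fun q => ?_
  rw [← mul_assoc, ← ENNReal.ofReal_mul (by positivity), norm_smul, Real.norm_of_nonneg hr0.le]
  congr 2
  · field_simp
  · congr 2
    field_simp

theorem lintegral_sphereLift (hE : finrank ℝ E = 2) (hF : finrank ℝ F = 2)
    {f : WithLp 2 (E × F) → ENNReal} (hf : Measurable f) :
    ∫⁻ z in closedBall 0 1 ×ˢ closedBall 0 1, f (sphereLift z) =
      ∫⁻ w in closedBall 0 1, ENNReal.ofReal (‖w‖⁻¹ ^ 2) * f (‖w‖⁻¹ • w) := by
  have : Nontrivial F := nontrivial_of_finrank_pos (R := ℝ) (by omega)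
  have : Nontrivial E := nontrivial_of_finrank_pos (R := ℝ) (by omega)
  have hball : ball (0 : E) 1 =ᵐ[volume] closedBall 0 1 :=
    ae_eq_of_subset_of_measure_ge ball_subset_closedBall
      (Measure.addHaar_closedBall_eq_addHaar_ball ..).le measurableSet_ball.nullMeasurableSet
      measure_closedBall_lt_top.ne
  have hfs : Measurable fun z : E × F => f (sphereLift z) := hf.comp measurable_sphereLift
  have hg : Measurable ((closedBall (0 : WithLp 2 (E × F)) 1).indicator
      fun w => ENNReal.ofReal (‖w‖⁻¹ ^ 2) * f (‖w‖⁻¹ • w)) :=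
    Measurable.indicator (by fun_prop) measurableSet_closedBall
  rw [← lintegral_indicator measurableSet_closedBall,
    ← (WithLp.volume_preserving_toLp E F).lintegral_comp hg,
    lintegral_prod_eq_lintegral_ball_prod hE hF
      (g := fun z => (closedBall (0 : WithLp 2 (E × F)) 1).indicator _ (WithLp.toLp 2 z))
      (hg.comp (WithLp.measurable_toLp 2 (E × F))),
    Measure.volume_eq_prod, ← Measure.prod_restrict, lintegral_prod _ hfs.aemeasurable,
    ← Measure.restrict_congr_set hball]
  refine setLIntegral_congr_fun measurableSet_ball fun p hp => ?_
  rw [← lintegral_indicator measurableSet_closedBall]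
  refine lintegral_congr_ae ((Measure.ae_ne volume (0 : F)).mono fun q hq => ?_)
  have hq' : ‖q‖ ≠ 0 := norm_ne_zero_iff.2 hq
  have hnorm : ‖‖q‖ • sphereLift (p, q)‖ = ‖q‖ := by
    rw [norm_smul, norm_sphereLift (mem_ball_zero_iff.1 hp).le hq, norm_norm, mul_one]
  simp only [Set.indicator, ← norm_smul_sphereLift (z := (p, q)) hq, mem_closedBall_zero_iff, hnorm]
  split_ifs
  · rw [← mul_assoc, ← ENNReal.ofReal_mul (by positivity), smul_smul, inv_mul_cancel₀ hq', one_smul,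
      ← mul_pow, mul_inv_cancel₀ hq']
    simp
  · simp

theorem map_sphereLift_isometry_invariant (hE : finrank ℝ E = 2) (hF : finrank ℝ F = 2)
    (e : WithLp 2 (E × F) ≃ₗᵢ[ℝ] WithLp 2 (E × F)) :
    ((volume.restrict (closedBall (0 : E) 1 ×ˢ closedBall (0 : F) 1)).map sphereLift).map e =
      (volume.restrict (closedBall (0 : E) 1 ×ˢ closedBall (0 : F) 1)).map sphereLift := by
  have he : Measurable e := e.continuous.measurable
  refine Measure.ext_of_lintegral _ fun f hf => ?_
  rw [lintegral_map hf he, lintegral_map (f := fun w => f (e w)) (hf.comp he) measurable_sphereLift,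
    lintegral_map hf measurable_sphereLift, lintegral_sphereLift hE hF hf,
    lintegral_sphereLift (f := fun w => f (e w)) hE hF (hf.comp he),
    ← e.measurePreserving.setLIntegral_comp_preimage
      (f := fun w => ENNReal.ofReal (‖w‖⁻¹ ^ 2) * f (‖w‖⁻¹ • w))
      measurableSet_closedBall (by fun_prop)]
  have hpre : e ⁻¹' closedBall 0 1 = closedBall 0 1 := by
    ext w
    simp
  simp only [hpre, map_smul, e.norm_map]

end

/-- `ℝᵐ × ℝⁿ` with the `L²` norm is isometric to `ℝᵐ⁺ⁿ` by concatenation of coordinates. -/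
noncomputable def euclideanSpaceAppend (m n : ℕ) :
    WithLp 2 (EuclideanSpace ℝ (Fin m) × EuclideanSpace ℝ (Fin n)) ≃ₗᵢ[ℝ]
      EuclideanSpace ℝ (Fin (m + n)) :=
  (PiLp.sumPiLpEquivProdLpPiLp 2 fun _ => ℝ).symm.trans
    (LinearIsometryEquiv.piLpCongrLeft 2 ℝ ℝ finSumFinEquiv)

theorem euclideanSpaceAppend_castAdd {m n : ℕ}
    (x : WithLp 2 (EuclideanSpace ℝ (Fin m) × EuclideanSpace ℝ (Fin n))) (i : Fin m) :
    euclideanSpaceAppend m n x (Fin.castAdd n i) = x.fst i := by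
  simp [euclideanSpaceAppend, LinearIsometryEquiv.piLpCongrLeft_apply, Equiv.piCongrLeft']

theorem euclideanSpaceAppend_natAdd {m n : ℕ}
    (x : WithLp 2 (EuclideanSpace ℝ (Fin m) × EuclideanSpace ℝ (Fin n))) (i : Fin n) :
    euclideanSpaceAppend m n x (Fin.natAdd m i) = x.snd i := by
  simp [euclideanSpaceAppend, LinearIsometryEquiv.piLpCongrLeft_apply, Equiv.piCongrLeft']

/-- correctness of Marsaglia's method for `n = 4`. If `(X₁, X₂)` and
`(a, b)` are independent, each uniform on the unit disk, with `S₁ = X₁² + X₂²` and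
`S₂ = a² + b²`, then `(X₁, X₂, a·√((1−S₁)/S₂), b·√((1−S₁)/S₂))` is uniform on
the unit sphere `S³ ⊂ ℝ⁴`. -/
theorem marsaglia_four_dim_uniform_on_sphere
    {Ω : Type*} [MeasureSpace Ω] [IsProbabilityMeasure (ℙ : Measure Ω)]
    (p q : Ω → EuclideanSpace ℝ (Fin 2)) (hpmeas : Measurable p) (hqmeas : Measurable q)
    (hp : Measure.map p ℙ = uniformBall 2) (hq : Measure.map q ℙ = uniformBall 2)
    (hindep : IndepFun p q ℙ)
    (S₁ S₂ : Ω → ℝ)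
    (hS₁ : ∀ ω, S₁ ω = (p ω 0) ^ 2 + (p ω 1) ^ 2)
    (hS₂ : ∀ ω, S₂ ω = (q ω 0) ^ 2 + (q ω 1) ^ 2)
    (V : Ω → EuclideanSpace ℝ (Fin 4))
    (hV0 : ∀ ω, V ω 0 = p ω 0)
    (hV1 : ∀ ω, V ω 1 = p ω 1)
    (hV2 : ∀ ω, V ω 2 = q ω 0 * Real.sqrt ((1 - S₁ ω) / S₂ ω))
    (hV3 : ∀ ω, V ω 3 = q ω 1 * Real.sqrt ((1 - S₁ ω) / S₂ ω)) :
    IsUniformSphere (Measure.map V ℙ) := by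

  have hV : V = fun ω => euclideanSpaceAppend 2 2 (sphereLift (p ω, q ω)) := by
    have hp_norm (ω) : S₁ ω = ‖p ω‖ ^ 2 := by
      rw [hS₁, EuclideanSpace.real_norm_sq_eq, Fin.sum_univ_two]
    have hq_norm (ω) : S₂ ω = ‖q ω‖ ^ 2 := by
      rw [hS₂, EuclideanSpace.real_norm_sq_eq, Fin.sum_univ_two]
    have hsqrt (ω) : √((1 - S₁ ω) / S₂ ω) = √(1 - ‖p ω‖ ^ 2) / ‖q ω‖ := by
      rw [hp_norm, hq_norm, Real.sqrt_div' _ (sq_nonneg _), Real.sqrt_sq (norm_nonneg _)]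
    funext ω
    ext i
    fin_cases i
    · exact (hV0 ω).trans (euclideanSpaceAppend_castAdd (sphereLift (p ω, q ω)) 0).symm
    · exact (hV1 ω).trans (euclideanSpaceAppend_castAdd (sphereLift (p ω, q ω)) 1).symm
    · refine (hV2 ω).trans (.trans ?_ (euclideanSpaceAppend_natAdd (m := 2) (n := 2) _ 0).symm)
      simp [sphereLift, hsqrt, mul_comm]
    · refine (hV3 ω).trans (.trans ?_ (euclideanSpaceAppend_natAdd (m := 2) (n := 2) _ 1).symm)
      simp [sphereLift, hsqrt, mul_comm]
  have hpq : Measurable fun ω => (p ω, q ω) := hpmeas.prodMk hqmeas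
  have hJ : Measurable (euclideanSpaceAppend 2 2) := (euclideanSpaceAppend 2 2).continuous.measurable
  have hVmeas : Measurable V := hV ▸ hJ.comp (measurable_sphereLift.comp hpq)
  refine ⟨Measure.isProbabilityMeasure_map hVmeas.aemeasurable, ?_, fun e => ?_⟩
  · have hp_ae : ∀ᵐ ω ∂ℙ, p ω ∈ closedBall (0 : EuclideanSpace ℝ (Fin 2)) 1 := by
      refine ae_of_ae_map hpmeas.aemeasurable ?_
      rw [hp]
      exact Measure.ae_smul_measure (ae_restrict_mem measurableSet_closedBall) _
    have hq_ae : ∀ᵐ ω ∂ℙ, q ω ≠ 0 := by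
      refine ae_of_ae_map (p := (· ≠ 0)) hqmeas.aemeasurable ?_
      rw [hq]
      exact Measure.ae_smul_measure (ae_restrict_of_ae (Measure.ae_ne volume 0)) _
    rw [Measure.map_apply hVmeas isClosed_sphere.measurableSet.compl]
    change ∀ᵐ ω ∂ℙ, V ω ∈ sphere 0 1
    filter_upwards [hp_ae, hq_ae] with ω hpω hqω
    rw [mem_sphere_zero_iff_norm, hV, LinearIsometryEquiv.norm_map,
      norm_sphereLift (mem_closedBall_zero_iff.1 hpω) hqω]
  · have hlaw : ∃ c : ENNReal, Measure.map (fun ω => (p ω, q ω)) ℙ =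
        c • volume.restrict (closedBall 0 1 ×ˢ closedBall 0 1) := by
      rw [(indepFun_iff_map_prod_eq_prod_map_map hpmeas.aemeasurable hqmeas.aemeasurable).1 hindep,
        hp, hq, uniformBall, Measure.prod_smul_left, Measure.prod_smul_right, smul_smul,
        Measure.prod_restrict]
      exact ⟨_, rfl⟩
    obtain ⟨c, hc⟩ := hlaw
    have hmap : Measure.map V ℙ = c • ((volume.restrict
        (closedBall 0 1 ×ˢ closedBall 0 1)).map sphereLift).map (euclideanSpaceAppend 2 2) := by
      rw [hV, ← Measure.map_smul, ← Measure.map_smul, ← hc, Measure.map_map measurable_sphereLift hpq,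
        Measure.map_map hJ (measurable_sphereLift.comp hpq)]
      rfl
    have he : Measurable e := e.continuous.measurable
    let e' := ((euclideanSpaceAppend 2 2).trans e).trans (euclideanSpaceAppend 2 2).symm
    have hconj : e ∘ euclideanSpaceAppend 2 2 = euclideanSpaceAppend 2 2 ∘ e' := by
      funext x
      simp [e']
    rw [hmap, Measure.map_smul, Measure.map_map he hJ, hconj,
      ← Measure.map_map hJ e'.continuous.measurable,
      map_sphereLift_isometry_invariant finrank_euclideanSpace_fin finrank_euclideanSpace_fin]
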